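/- arXiv:1004.4873 — 3 statements merged into one kernel-verified Lean document; each statement's English description precedes it below -/
import Mathlib

section
/- Let D ⊆ ℝⁿ be open, let ℓ be a local action on D, and let b : D → ℝⁿ be a C¹ vector field. Let q₁ < q₂ and let f : D → ℝ trace the flowlines of b between q₁ and q₂; set E_f := f⁻¹((q₁,q₂)) and assume the closure of E_f is a compact subset of D. Assume there are constants A > 0 with ℓ(x,y) ≥ A·(|b(x)|·|y| − ⟨b(x),y⟩) for all x in the closure of E_f and all y ∈ ℝⁿ, G := min{|b(x)| : x ∈ closure of E_f} > 0, and H := sup{|∇f(x)| : x ∈ E_f} < ∞. Then for every absolutely continuous φ : [0,1] → D with φ(0) = x₁ and φ(1) = x₂: ∫₀¹ |φ′(α)|·1_{f(φ(α)) ∈ (q₁,q₂)} dα ≤ (2H²/(A·G))·∫₀¹ ℓ(φ(α),φ′(α)) dα + 2·|h(f(x₁)) − h(f(x₂))|, where h(a) := min(max(a,q₁),q₂). -/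
open MeasureTheory Set Filter
open scoped RealInnerProductSpace

abbrev Euc (n : ℕ) := EuclideanSpace ℝ (Fin n)

/-- `φ` is absolutely continuous on `[0,1]` with derivative `φ'`. -/
def GeoAC {n : ℕ} (φ φ' : ℝ → Euc n) : Prop :=
  MeasureTheory.IntegrableOn φ' (Set.Icc 0 1) ∧
    ∀ t ∈ Set.Icc (0:ℝ) 1, φ t = φ 0 + ∫ s in (0:ℝ)..t, φ' s

open scoped Topology in
lemma sub_le_sub_of_eventually_sub_le {g V : ℝ → ℝ} {a b q₁ q₂ : ℝ} (hab : a ≤ b)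
    (hg : ContinuousOn g (Icc a b)) (hV : ContinuousOn V (Icc a b))
    (hmono : MonotoneOn V (Icc a b)) (hbd : ∀ x ∈ Icc a b, g x ∈ Icc q₁ q₂)
    (hloc : ∀ x ∈ Ico a b, g x ∈ Ioo q₁ q₂ → ∀ᶠ r in 𝓝[>] x, g r - g x ≤ V r - V x) :
    g b - g a ≤ V b - V a := by
  have ha : a ∈ Icc a b := left_mem_Icc.2 hab
  have hb : b ∈ Icc a b := right_mem_Icc.2 hab
  by_cases hgab : g b ≤ g a
  · linarith [hmono ha hb hab]
  push Not at hgab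
  obtain ⟨s, ⟨hs, hgs⟩, hsmax⟩ : ∃ s, IsGreatest (Icc a b ∩ g ⁻¹' Iic (g a)) s :=
    (isCompact_Icc.of_isClosed_subset (hg.preimage_isClosed_of_isClosed isClosed_Icc isClosed_Iic)
      inter_subset_left).exists_isGreatest ⟨a, ha, by simp⟩
  have hsb : s < b := by
    rcases hs.2.lt_or_eq with h | h
    · exact h
    · subst h; exact absurd hgs (not_le.2 hgab)
  have hW : ContinuousOn (fun r => g r - V r) (Icc a b) := hg.sub hV
  have key : ∀ c ∈ Ioo s b, g b - V b ≤ g c - V c := by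
    intro c hc
    have hsub : Icc c b ⊆ Icc a b := Icc_subset_Icc_left (hs.1.trans hc.1.le)
    refine IsClosed.Icc_subset_of_forall_mem_nhdsWithin
      (s := {r | g r - V r ≤ g c - V c}) ?_ (le_refl (g c - V c)) ?_ (right_mem_Icc.2 hc.2.le)
    · rw [inter_comm]
      exact (hW.mono hsub).preimage_isClosed_of_isClosed isClosed_Icc isClosed_Iic
    · rintro x ⟨hx, hxc, hxb⟩
      have hxI : x ∈ Icc a b := hsub ⟨hxc, hxb.le⟩
      have hga : g a < g x := by
        by_contra! h
        exact absurd (hsmax ⟨hxI, h⟩) (not_le.2 (hc.1.trans_le hxc))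
      have hmem : ∀ᶠ r in 𝓝[>] x, r ∈ Ioo x b := Ioo_mem_nhdsGT hxb
      have hinc : ∀ᶠ r in 𝓝[>] x, g r - g x ≤ V r - V x := by
        rcases (hbd x hxI).2.lt_or_eq with h | h
        · exact hloc x ⟨hxI.1, hxb⟩ ⟨(hbd a ha).1.trans_lt hga, h⟩
        · filter_upwards [hmem] with r hr
          have hrI : r ∈ Icc a b := ⟨hxI.1.trans hr.1.le, hr.2.le⟩
          linarith [(hbd r hrI).2, hmono hxI hrI hr.1.le]
      filter_upwards [hinc] with r hr
      simp only [mem_ofPred_eq] at hx ⊢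
      linarith
  have hlim : Tendsto (fun r => g r - V r) (𝓝[>] s) (𝓝 (g s - V s)) :=
    (hW s hs).mono_left
      (nhdsWithin_le_iff.2 (mem_of_superset (Ioo_mem_nhdsGT hsb) fun r hr =>
        ⟨hs.1.trans hr.1.le, hr.2.le⟩))
  have := ge_of_tendsto hlim (mem_of_superset (Ioo_mem_nhdsGT hsb) key)
  have h1 : g s ≤ g a := hgs
  linarith [hmono ha hs hs.1]

open scoped Topology in
lemma abs_sub_le_sub_of_eventually_abs_sub_le {g V : ℝ → ℝ} {a b q₁ q₂ : ℝ} (hab : a ≤ b)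
    (hg : ContinuousOn g (Icc a b)) (hV : ContinuousOn V (Icc a b))
    (hmono : MonotoneOn V (Icc a b)) (hbd : ∀ x ∈ Icc a b, g x ∈ Icc q₁ q₂)
    (hloc : ∀ x ∈ Ico a b, g x ∈ Ioo q₁ q₂ → ∀ᶠ r in 𝓝[>] x, |g r - g x| ≤ V r - V x) :
    |g b - g a| ≤ V b - V a := by
  rw [abs_le]
  constructor
  · have := sub_le_sub_of_eventually_sub_le (g := fun x => -g x) (q₁ := -q₂) (q₂ := -q₁) hab hg.neg
      hV hmono (fun x hx => ⟨neg_le_neg (hbd x hx).2, neg_le_neg (hbd x hx).1⟩)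
      (fun x hx hgx => by
        filter_upwards [hloc x hx ⟨neg_lt_neg_iff.1 hgx.2, neg_lt_neg_iff.1 hgx.1⟩] with r hr
        linarith [(abs_le.1 hr).1])
    linarith
  · exact sub_le_sub_of_eventually_sub_le hab hg hV hmono hbd fun x hx hgx =>
      (hloc x hx hgx).mono fun r hr => (le_abs_self _).trans hr

lemma norm_le_drift_add_inner {E : Type*} [NormedAddCommGroup E] [InnerProductSpace ℝ E]
    {p β y : E} {A G H L : ℝ} (hA : 0 < A) (hG : 0 < G) (hp : ⟪p, β⟫ = ‖β‖) (hβ : G ≤ ‖β‖)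
    (hH : ‖p‖ ≤ H) (hL : A * (‖β‖ * ‖y‖ - ⟪β, y⟫) ≤ L) :
    ‖y‖ ≤ 2 * H ^ 2 / (A * G) * L + 2 * ⟪p, y⟫ := by
  have hβ0 : 0 < ‖β‖ := hG.trans_le hβ
  have hH0 : 0 ≤ H := (norm_nonneg p).trans hH
  set e : E := ‖β‖⁻¹ • β with he
  have hpe : ⟪p, e⟫ = 1 := by
    rw [he, inner_smul_right, hp, inv_mul_cancel₀ hβ0.ne']
  have hey : ‖β‖ * ⟪e, y⟫ = ⟪β, y⟫ := by
    rw [he, real_inner_smul_left, mul_inv_cancel_left₀ hβ0.ne']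
  have hne : ‖e‖ = 1 := by
    rw [he, norm_smul, norm_inv, norm_norm, inv_mul_cancel₀ hβ0.ne']
  set d := ‖y‖ - ⟪e, y⟫ with hd
  have hd0 : 0 ≤ d := by
    have := real_inner_le_norm e y
    rw [hne, one_mul] at this
    linarith
  have hdL : A * G * d ≤ L := by
    calc A * G * d ≤ A * ‖β‖ * d := by gcongr
      _ = A * (‖β‖ * ‖y‖ - ⟪β, y⟫) := by rw [← hey, hd]; ring
      _ ≤ L := hL
  have hw : ‖y - ‖y‖ • e‖ ^ 2 = 2 * ‖y‖ * d := by
    rw [norm_sub_sq_real, norm_smul, norm_norm, hne, inner_smul_right, real_inner_comm, hd]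
    ring
  have hpw : -(H * ‖y - ‖y‖ • e‖) ≤ ⟪p, y⟫ - ‖y‖ := by
    have h1 : ⟪p, y - ‖y‖ • e⟫ = ⟪p, y⟫ - ‖y‖ := by
      rw [inner_sub_right, inner_smul_right, hpe, mul_one]
    have h2 := neg_le_of_abs_le (abs_real_inner_le_norm p (y - ‖y‖ • e))
    rw [h1] at h2
    have h3 : ‖p‖ * ‖y - ‖y‖ • e‖ ≤ H * ‖y - ‖y‖ • e‖ := by gcongr
    linarith
  have hamgm : H * ‖y - ‖y‖ • e‖ ≤ ‖y‖ / 2 + H ^ 2 * d := by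
    refine abs_le_of_sq_le_sq' ?_ (by positivity) |>.2
    rw [mul_pow, hw]
    nlinarith [sq_nonneg (‖y‖ / 2 - H ^ 2 * d)]
  have hfin : H ^ 2 * d ≤ H ^ 2 / (A * G) * L := by
    rw [div_mul_eq_mul_div, le_div_iff₀ (by positivity)]
    nlinarith [mul_le_mul_of_nonneg_left hdL (sq_nonneg H)]
  have : 2 * H ^ 2 / (A * G) * L = 2 * (H ^ 2 / (A * G) * L) := by ring
  linarith

lemma AbsolutelyContinuousOnInterval.of_dist_le {X Y : Type*} [PseudoMetricSpace X]
    [PseudoMetricSpace Y] {g : ℝ → X} {V : ℝ → Y} {a b : ℝ}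
    (hV : AbsolutelyContinuousOnInterval V a b)
    (h : ∀ s ∈ uIcc a b, ∀ t ∈ uIcc a b, dist (g s) (g t) ≤ dist (V s) (V t)) :
    AbsolutelyContinuousOnInterval g a b := by
  rw [absolutelyContinuousOnInterval_iff] at hV ⊢
  intro ε hε
  obtain ⟨δ, hδ, H⟩ := hV ε hε
  exact ⟨δ, hδ, fun E hE hlt => (Finset.sum_le_sum fun i hi =>
    h _ (hE.1 i hi).1 _ (hE.1 i hi).2).trans_lt (H E hE hlt)⟩

/-- A continuous, fibrewise positively homogeneous integrand is integrable along an absolutely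
continuous curve. -/
lemma integrableOn_homogeneous_comp {E : Type*} [NormedAddCommGroup E] [NormedSpace ℝ E]
    [FiniteDimensional ℝ E] [MeasurableSpace E] [BorelSpace E] {D : Set E} (hD : IsOpen D)
    {ℓ : E → E → ℝ}
    (hcont : ContinuousOn (fun p : E × E => ℓ p.1 p.2) (D ×ˢ univ))
    (hhom : ∀ x ∈ D, ∀ y : E, ∀ c : ℝ, 0 ≤ c → ℓ x (c • y) = c * ℓ x y)
    {φ ψ : ℝ → E} {a b : ℝ} (hφ : ContinuousOn φ (Icc a b)) (hφD : ∀ t ∈ Icc a b, φ t ∈ D)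
    (hψ : IntegrableOn ψ (Icc a b)) :
    IntegrableOn (fun t => ℓ (φ t) (ψ t)) (Icc a b) := by
  classical
  obtain ⟨C, hC⟩ := ((isCompact_Icc.image_of_continuousOn hφ).prod
    (isCompact_sphere (0 : E) 1)).exists_bound_of_continuousOn
    (hcont.mono (prod_mono (by rintro _ ⟨t, ht, rfl⟩; exact hφD t ht) (subset_univ _)))
  have hmeas : AEStronglyMeasurable (fun t => ℓ (φ t) (ψ t)) (volume.restrict (Icc a b)) := by
    have hM : Measurable ((D ×ˢ (univ : Set E)).piecewise
        (fun p : E × E => ℓ p.1 p.2) (fun _ => 0)) :=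
      hcont.measurable_piecewise continuousOn_const (hD.prod isOpen_univ).measurableSet
    have hpair := (hφ.aestronglyMeasurable_of_isCompact isCompact_Icc
      measurableSet_Icc (μ := volume)).aemeasurable.prodMk hψ.aestronglyMeasurable.aemeasurable
    refine (hM.comp_aemeasurable hpair).aestronglyMeasurable.congr ?_
    filter_upwards [ae_restrict_mem measurableSet_Icc] with t ht
    simp [Function.comp, hφD t ht]
  refine (hψ.norm.const_mul C).mono' hmeas ?_
  filter_upwards [ae_restrict_mem measurableSet_Icc] with t ht
  rcases eq_or_ne (ψ t) 0 with h | h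
  · have := hhom _ (hφD t ht) (ψ t) 0 le_rfl
    rw [zero_smul, zero_mul] at this
    simp [h, this]
  · have h0 : 0 < ‖ψ t‖ := norm_pos_iff.2 h
    have h1 := hhom _ (hφD t ht) (‖ψ t‖⁻¹ • ψ t) ‖ψ t‖ h0.le
    rw [smul_inv_smul₀ h0.ne'] at h1
    rw [h1, norm_mul, norm_norm, mul_comm]
    gcongr
    refine hC (φ t, ‖ψ t‖⁻¹ • ψ t) ⟨mem_image_of_mem _ ht, ?_⟩
    simp [norm_smul, h0.ne']

namespace GeoAC

variable {n : ℕ} {φ φ' : ℝ → Euc n}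

lemma intervalIntegrable (h : GeoAC φ φ') {s t : ℝ} (hs : s ∈ Icc (0 : ℝ) 1)
    (ht : t ∈ Icc (0 : ℝ) 1) : IntervalIntegrable φ' volume s t :=
  (h.1.mono_set (uIcc_subset_Icc hs ht)).intervalIntegrable

lemma continuousOn (h : GeoAC φ φ') : ContinuousOn φ (Icc 0 1) := by
  have hprim : ContinuousOn (fun t => φ 0 + ∫ s in (0 : ℝ)..t, φ' s) (Icc 0 1) := by
    rw [← uIcc_of_le zero_le_one]
    refine continuousOn_const.add (intervalIntegral.continuousOn_primitive_interval ?_)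
    rw [uIcc_of_le zero_le_one]
    exact h.1
  exact hprim.congr h.2

lemma sub_eq_integral (h : GeoAC φ φ') {s t : ℝ} (hs : s ∈ Icc (0 : ℝ) 1)
    (ht : t ∈ Icc (0 : ℝ) 1) : φ t - φ s = ∫ r in s..t, φ' r := by
  have h0 : (0 : ℝ) ∈ Icc (0 : ℝ) 1 := by simp
  rw [h.2 t ht, h.2 s hs, add_sub_add_left_eq_sub,
    intervalIntegral.integral_interval_sub_left (h.intervalIntegrable h0 ht)
      (h.intervalIntegrable h0 hs)]

lemma ae_hasDerivAt (h : GeoAC φ φ') :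
    ∀ᵐ t, t ∈ Ioo (0 : ℝ) 1 → HasDerivAt φ (φ' t) t := by
  filter_upwards [(h.intervalIntegrable (s := 0) (t := 1)
    (by simp) (by simp)).ae_hasDerivAt_integral] with t ht htI
  rw [uIcc_of_le zero_le_one] at ht
  refine ((ht (Ioo_subset_Icc_self htI) 0 (by simp)).const_add (φ 0)).congr_of_eventuallyEq ?_
  filter_upwards [Ioo_mem_nhds htI.1 htI.2] with r hr
  exact h.2 r (Ioo_subset_Icc_self hr)

end GeoAC

section Truncation

variable {n : ℕ} {D : Set (Euc n)} {f : Euc n → ℝ} {q₁ q₂ H : ℝ} {φ φ' : ℝ → Euc n}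

lemma norm_fderiv_eq_norm_gradient (x : Euc n) : ‖fderiv ℝ f x‖ = ‖gradient f x‖ := by
  rw [← toDual_gradient, LinearIsometryEquiv.norm_map]

lemma absolutelyContinuousOnInterval_truncation_comp (hq : q₁ < q₂) (hH : 0 ≤ H)
    (hE : IsOpen {w ∈ D | f w ∈ Ioo q₁ q₂}) (hfcont : ContinuousOn f D)
    (hfd : ∀ x ∈ {w ∈ D | f w ∈ Ioo q₁ q₂}, DifferentiableAt ℝ f x)
    (hfH : ∀ x ∈ {w ∈ D | f w ∈ Ioo q₁ q₂}, ‖gradient f x‖ ≤ H)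
    (hAC : GeoAC φ φ') (hφD : ∀ t ∈ Icc (0 : ℝ) 1, φ t ∈ D) :
    AbsolutelyContinuousOnInterval (fun t => min (max (f (φ t)) q₁) q₂) 0 1 := by
  have hnorm {s t : ℝ} (hs : s ∈ Icc (0 : ℝ) 1) (ht : t ∈ Icc (0 : ℝ) 1) :
      IntervalIntegrable (fun r => ‖φ' r‖) volume s t := (hAC.intervalIntegrable hs ht).norm
  have h0 : (0 : ℝ) ∈ Icc (0 : ℝ) 1 := by simp
  have h1 : (1 : ℝ) ∈ Icc (0 : ℝ) 1 := by simp
  set V : ℝ → ℝ := fun t => H * ∫ r in (0 : ℝ)..t, ‖φ' r‖ with hVdef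
  have hVAC : AbsolutelyContinuousOnInterval V 0 1 :=
    ((hnorm h0 h1).absolutelyContinuousOnInterval_intervalIntegral (by simp)).const_mul H
  have hVsub {s t : ℝ} (hs : s ∈ Icc (0 : ℝ) 1) (ht : t ∈ Icc (0 : ℝ) 1) :
      V t - V s = H * ∫ r in s..t, ‖φ' r‖ := by
    rw [hVdef, ← mul_sub, intervalIntegral.integral_interval_sub_left (hnorm h0 ht) (hnorm h0 hs)]
  have hVmono : MonotoneOn V (Icc 0 1) := fun s hs t ht hst => by
    rw [← sub_nonneg, hVsub hs ht]
    exact mul_nonneg hH (intervalIntegral.integral_nonneg hst fun _ _ => norm_nonneg _)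
  have hVcont : ContinuousOn V (Icc 0 1) := by
    simpa [uIcc_of_le zero_le_one] using hVAC.continuousOn
  have hφc := hAC.continuousOn
  have hgc : ContinuousOn (fun t => min (max (f (φ t)) q₁) q₂) (Icc 0 1) :=
    ((hfcont.comp hφc hφD).sup continuousOn_const).inf continuousOn_const
  have hloc : ∀ x ∈ Ico (0 : ℝ) 1, min (max (f (φ x)) q₁) q₂ ∈ Ioo q₁ q₂ →
      ∀ᶠ r in nhdsWithin x (Ioi x),
        |min (max (f (φ r)) q₁) q₂ - min (max (f (φ x)) q₁) q₂| ≤ V r - V x := by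
    intro x hx hgx
    have hxI : x ∈ Icc (0 : ℝ) 1 := Ico_subset_Icc_self hx
    have hxE : φ x ∈ {w ∈ D | f w ∈ Ioo q₁ q₂} := ⟨hφD x hxI, by grind⟩
    obtain ⟨ε, hε, hball⟩ := Metric.isOpen_iff.1 hE _ hxE
    have hIoo : Ioo x 1 ∈ nhdsWithin x (Ioi x) := Ioo_mem_nhdsGT hx.2
    have hlim : Tendsto φ (nhdsWithin x (Ioi x)) (nhds (φ x)) :=
      (hφc x hxI).mono_left (nhdsWithin_le_iff.2 (mem_of_superset hIoo fun r hr =>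
        ⟨hx.1.trans hr.1.le, hr.2.le⟩))
    filter_upwards [hIoo, hlim (Metric.ball_mem_nhds _ hε)] with r hr hrb
    have hrI : r ∈ Icc (0 : ℝ) 1 := ⟨hx.1.trans hr.1.le, hr.2.le⟩
    have hLip := (convex_ball (φ x) ε).norm_image_sub_le_of_norm_fderiv_le
      (fun y hy => hfd y (hball hy))
      (fun y hy => (norm_fderiv_eq_norm_gradient y).trans_le (hfH y (hball hy)))
      (Metric.mem_ball_self hε) hrb
    calc |min (max (f (φ r)) q₁) q₂ - min (max (f (φ x)) q₁) q₂| ≤ |f (φ r) - f (φ x)| :=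
          (abs_min_sub_min_le_max _ _ _ _).trans (by
            simpa using abs_max_sub_max_le_abs (f (φ r)) (f (φ x)) q₁)
      _ ≤ H * ‖φ r - φ x‖ := hLip
      _ ≤ H * ∫ u in x..r, ‖φ' u‖ := by
          rw [hAC.sub_eq_integral hxI hrI]
          gcongr
          exact intervalIntegral.norm_integral_le_integral_norm hr.1.le
      _ = V r - V x := (hVsub hxI hrI).symm
  have hle : ∀ s ∈ Icc (0 : ℝ) 1, ∀ t ∈ Icc (0 : ℝ) 1, s ≤ t →
      |min (max (f (φ t)) q₁) q₂ - min (max (f (φ s)) q₁) q₂| ≤ V t - V s := by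
    intro s hs t ht hst
    have hsub : Icc s t ⊆ Icc 0 1 := Icc_subset_Icc hs.1 ht.2
    exact abs_sub_le_sub_of_eventually_abs_sub_le hst (hgc.mono hsub) (hVcont.mono hsub)
      (hVmono.mono hsub) (fun x _ => ⟨le_min (le_max_right _ _) hq.le, min_le_right _ _⟩)
      (fun x hx => hloc x ⟨hs.1.trans hx.1, hx.2.trans_le ht.2⟩)
  refine hVAC.of_dist_le fun s hs t ht => ?_
  rw [uIcc_of_le zero_le_one] at hs ht
  rcases le_total s t with hst | hst
  · rw [dist_comm, dist_comm (V s), Real.dist_eq, Real.dist_eq]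
    exact (hle s hs t ht hst).trans (le_abs_self _)
  · rw [Real.dist_eq, Real.dist_eq]
    exact (hle t ht s hs hst).trans (le_abs_self _)

lemma deriv_truncation_comp_of_mem {t : ℝ} (hE : IsOpen {w ∈ D | f w ∈ Ioo q₁ q₂})
    (hfd : DifferentiableAt ℝ f (φ t)) (hφ : HasDerivAt φ (φ' t) t)
    (ht : φ t ∈ {w ∈ D | f w ∈ Ioo q₁ q₂}) :
    deriv (fun t => min (max (f (φ t)) q₁) q₂) t = ⟪gradient f (φ t), φ' t⟫ := by
  have hcomp : HasDerivAt (f ∘ φ) (fderiv ℝ f (φ t) (φ' t)) t :=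
    hfd.hasFDerivAt.comp_hasDerivAt t hφ
  rw [inner_gradient_left]
  refine (hcomp.congr_of_eventuallyEq ?_).deriv
  filter_upwards [hφ.continuousAt (hE.mem_nhds ht)] with r hr
  have hr2 : f (φ r) ∈ Ioo q₁ q₂ := hr.2
  simp [hr2.1.le, hr2.2.le]

lemma deriv_truncation_comp_of_notMem {u : ℝ → ℝ} {t : ℝ} (hq : q₁ < q₂)
    (ht : u t ∉ Ioo q₁ q₂) : deriv (fun t => min (max (u t) q₁) q₂) t = 0 := by
  by_cases h : u t ≤ q₁
  · refine IsLocalMin.deriv_eq_zero (Eventually.of_forall fun r => ?_)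
    simp [h, hq.le]
  · refine IsLocalMax.deriv_eq_zero (Eventually.of_forall fun r => ?_)
    have h2 : q₂ ≤ u t := by grind
    simp [h2]

end Truncation

/-- the key estimate.  If `f` traces the flowlines of `b` between
`q₁` and `q₂`, then the portion of the length of a curve spent in
`f⁻¹((q₁,q₂))` is controlled by its action plus the net change of the
truncation `h ∘ f` between the endpoints. -/
theorem statement14 {n : ℕ} (D : Set (Euc n)) (hD : IsOpen D) (hDne : D.Nonempty)
    (ℓ : Euc n → Euc n → ℝ)
    (hℓcont : ContinuousOn (fun p : Euc n × Euc n => ℓ p.1 p.2) (D ×ˢ Set.univ))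
    (hℓnonneg : ∀ x ∈ D, ∀ y : Euc n, 0 ≤ ℓ x y)
    (hℓhom : ∀ x ∈ D, ∀ y : Euc n, ∀ c : ℝ, 0 ≤ c → ℓ x (c • y) = c * ℓ x y)
    (hℓconv : ∀ x ∈ D, ConvexOn ℝ Set.univ (fun y => ℓ x y))
    (b : Euc n → Euc n) (hb : ContDiffOn ℝ 1 b D)
    (q₁ q₂ : ℝ) (hq : q₁ < q₂)
    (f : Euc n → ℝ) (hfcont : ContinuousOn f D)
    (hfC1 : ContDiffOn ℝ 1 f {w ∈ D | f w ∈ Set.Ioo q₁ q₂})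
    (hftrace : (∀ x ∈ {w ∈ D | f w ∈ Set.Ioo q₁ q₂}, ⟪gradient f x, b x⟫ = ‖b x‖) ∨
               (∀ x ∈ {w ∈ D | f w ∈ Set.Ioo q₁ q₂}, ⟪gradient f x, b x⟫ = -‖b x‖))
    (hEcomp : IsCompact (closure {w ∈ D | f w ∈ Set.Ioo q₁ q₂}))
    (hEsub : closure {w ∈ D | f w ∈ Set.Ioo q₁ q₂} ⊆ D)
    (A : ℝ) (hA : 0 < A)
    (hdrift : ∀ x ∈ closure {w ∈ D | f w ∈ Set.Ioo q₁ q₂}, ∀ y : Euc n,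
      A * (‖b x‖ * ‖y‖ - ⟪b x, y⟫) ≤ ℓ x y)
    (G : ℝ) (hG : 0 < G)
    (hGmin : ∀ x ∈ closure {w ∈ D | f w ∈ Set.Ioo q₁ q₂}, G ≤ ‖b x‖)
    (Hb : ℝ) (hHsup : ∀ x ∈ {w ∈ D | f w ∈ Set.Ioo q₁ q₂}, ‖gradient f x‖ ≤ Hb)
    (φ φ' : ℝ → Euc n) (hAC : GeoAC φ φ')
    (hφD : ∀ t ∈ Set.Icc (0:ℝ) 1, φ t ∈ D) :
    (∫ α in (0:ℝ)..1, (Set.Ioo q₁ q₂).indicator (fun _ => ‖φ' α‖) (f (φ α))) ≤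
      (2 * Hb ^ 2 / (A * G)) * (∫ α in (0:ℝ)..1, ℓ (φ α) (φ' α)) +
        2 * |min (max (f (φ 0)) q₁) q₂ - min (max (f (φ 1)) q₁) q₂| := by
  have hE : IsOpen {w ∈ D | f w ∈ Ioo q₁ q₂} := hfcont.isOpen_inter_preimage hD isOpen_Ioo
  have hfd : ∀ x ∈ {w ∈ D | f w ∈ Ioo q₁ q₂}, DifferentiableAt ℝ f x := fun x hx =>
    (hfC1.differentiableOn one_ne_zero).differentiableAt (hE.mem_nhds hx)
  obtain ⟨σ, hσ, hσtrace⟩ : ∃ σ : ℝ, |σ| = 1 ∧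
      ∀ x ∈ {w ∈ D | f w ∈ Ioo q₁ q₂}, ⟪σ • gradient f x, b x⟫ = ‖b x‖ := by
    rcases hftrace with h | h
    · exact ⟨1, by simp, fun x hx => by simp [h x hx]⟩
    · exact ⟨-1, by simp, fun x hx => by simp [inner_neg_left, h x hx]⟩
  have hℓint : IntervalIntegrable (fun t => ℓ (φ t) (φ' t)) volume 0 1 := by
    rw [intervalIntegrable_iff_integrableOn_Icc_of_le zero_le_one]
    exact integrableOn_homogeneous_comp hD hℓcont hℓhom hAC.continuousOn hφD hAC.1
  have hK : 0 ≤ 2 * Hb ^ 2 / (A * G) := by positivity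
  rcases eq_empty_or_nonempty {w ∈ D | f w ∈ Ioo q₁ q₂} with hempty | ⟨x₀, hx₀⟩
  · have hzero : ∫ α in (0:ℝ)..1, (Ioo q₁ q₂).indicator (fun _ => ‖φ' α‖) (f (φ α)) = 0 := by
      rw [intervalIntegral.integral_congr (g := fun _ => 0), intervalIntegral.integral_zero]
      intro t ht
      rw [uIcc_of_le zero_le_one] at ht
      exact indicator_of_notMem (fun h => notMem_empty (φ t) (hempty ▸ ⟨hφD t ht, h⟩)) _
    rw [hzero]
    have hℓ0 : 0 ≤ ∫ α in (0:ℝ)..1, ℓ (φ α) (φ' α) :=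
      intervalIntegral.integral_nonneg zero_le_one fun t ht => hℓnonneg (φ t) (hφD t ht) (φ' t)
    exact add_nonneg (mul_nonneg hK hℓ0) (by positivity)
  have hgAC := absolutelyContinuousOnInterval_truncation_comp hq
    ((norm_nonneg _).trans (hHsup x₀ hx₀)) hE hfcont hfd hHsup hAC hφD
  set g : ℝ → ℝ := fun t => min (max (f (φ t)) q₁) q₂ with hg
  have hbound : ∀ᵐ t, t ∈ Ioc (0 : ℝ) 1 →
      (Ioo q₁ q₂).indicator (fun _ => ‖φ' t‖) (f (φ t)) ≤
        2 * Hb ^ 2 / (A * G) * ℓ (φ t) (φ' t) + 2 * σ * deriv g t := by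
    filter_upwards [hAC.ae_hasDerivAt, Measure.ae_ne volume (1 : ℝ)] with t hφt ht1 ht
    have hφt := hφt ⟨ht.1, ht.2.lt_of_ne ht1⟩
    have htD : φ t ∈ D := hφD t (Ioc_subset_Icc_self ht)
    by_cases hft : f (φ t) ∈ Ioo q₁ q₂
    · have htE : φ t ∈ {w ∈ D | f w ∈ Ioo q₁ q₂} := ⟨htD, hft⟩
      rw [indicator_of_mem hft, hg, deriv_truncation_comp_of_mem hE (hfd _ htE) hφt htE]
      have hcl := subset_closure htE
      have := norm_le_drift_add_inner (H := Hb) hA hG (hσtrace _ htE) (hGmin _ hcl)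
        (by rw [norm_smul, Real.norm_eq_abs, hσ, one_mul]; exact hHsup _ htE)
        (hdrift _ hcl (φ' t))
      rwa [real_inner_smul_left, ← mul_assoc] at this
    · rw [indicator_of_notMem hft, hg, deriv_truncation_comp_of_notMem hq hft, mul_zero, add_zero]
      exact mul_nonneg hK (hℓnonneg _ htD _)
  have hRint := (hℓint.const_mul (2 * Hb ^ 2 / (A * G))).add
    (hgAC.intervalIntegrable_deriv.const_mul (2 * σ))
  have hmono : (∫ α in (0:ℝ)..1, (Ioo q₁ q₂).indicator (fun _ => ‖φ' α‖) (f (φ α))) ≤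
      ∫ t in (0:ℝ)..1, (2 * Hb ^ 2 / (A * G) * ℓ (φ t) (φ' t) + 2 * σ * deriv g t) := by
    rw [intervalIntegral.integral_of_le zero_le_one, intervalIntegral.integral_of_le zero_le_one]
    exact integral_mono_of_nonneg
      (Eventually.of_forall fun t => indicator_nonneg (fun _ _ => norm_nonneg _) _)
      hRint.1 ((ae_restrict_iff' measurableSet_Ioc).2 hbound)
  rw [intervalIntegral.integral_add (hℓint.const_mul _)
    (hgAC.intervalIntegrable_deriv.const_mul _), intervalIntegral.integral_const_mul,
    intervalIntegral.integral_const_mul, hgAC.integral_deriv_eq_sub] at hmono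
  refine hmono.trans (add_le_add_right ?_ _)
  calc 2 * σ * (g 1 - g 0) = 2 * (σ * (g 1 - g 0)) := mul_assoc _ _ _
    _ ≤ 2 * |σ * (g 1 - g 0)| := by gcongr; exact le_abs_self _
    _ = 2 * |g 0 - g 1| := by rw [abs_mul, hσ, one_mul, abs_sub_comm]
end

section
/- Let D ⊆ ℝⁿ be open, let H : D × ℝⁿ → ℝ be continuous and satisfy (H1′) H(x,0) = 0 for all x ∈ D, together with (H2) and (H3), let ℓ(x,y) := sup{⟨y,θ⟩ : θ ∈ ℝⁿ, H(x,θ) ≤ 0}, and set b(x) := H_θ(x,0). Then: (a) ℓ(x, c·b(x)) = 0 for every x ∈ D and every c ≥ 0; (b) consequently, if φ : [0,1] → D is absolutely continuous and there is a measurable function c : [0,1] → [0,∞) with φ′(α) = c(α)·b(φ(α)) for almost every α ∈ [0,1], then ∫₀¹ ℓ(φ(α), φ′(α)) dα = 0. -/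
open MeasureTheory Set Filter
open scoped RealInnerProductSpace

/-- First-order convexity inequality at the origin: a function with gradient `g` whose
derivative `A` is positive semidefinite lies above its tangent plane at `0`. -/
theorem inner_gradient_zero_le_sub {E : Type*} [NormedAddCommGroup E] [InnerProductSpace ℝ E]
    [CompleteSpace E] {f : E → ℝ} {g : E → E} {A : E → E →L[ℝ] E}
    (hf : ∀ θ, HasGradientAt f (g θ) θ) (hg : ∀ θ, HasFDerivAt g (A θ) θ)
    (hA : ∀ θ ξ, 0 ≤ ⟪ξ, A θ ξ⟫) (θ : E) : ⟪g 0, θ⟫ ≤ f θ - f 0 := by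
  have hline (t : ℝ) : HasDerivAt (fun s : ℝ => s • θ) θ t := by
    simpa using (hasDerivAt_id t).smul_const θ
  have hf' (t : ℝ) : HasDerivAt (fun s : ℝ => f (s • θ)) ⟪g (t • θ), θ⟫ t := by
    simpa [Function.comp_def] using (hf (t • θ)).hasFDerivAt.comp_hasDerivAt t (hline t)
  have hg' (t : ℝ) : HasDerivAt (fun s : ℝ => ⟪g (s • θ), θ⟫) ⟪A (t • θ) θ, θ⟫ t := by
    simpa using ((hg (t • θ)).comp_hasDerivAt t (hline t)).inner ℝ (hasDerivAt_const t θ)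
  have hmono : Monotone fun s : ℝ => ⟪g (s • θ), θ⟫ := by
    refine monotone_of_deriv_nonneg (fun t => (hg' t).differentiableAt) fun t => ?_
    rw [(hg' t).deriv, real_inner_comm]
    exact hA _ _
  obtain ⟨s, hs, hs'⟩ := exists_hasDerivAt_eq_slope (fun s : ℝ => f (s • θ)) _ zero_lt_one
    (fun t _ => (hf' t).continuousAt.continuousWithinAt) fun t _ => hf' t
  have h := hmono hs.1.le
  simp only [zero_smul, one_smul, sub_zero, div_one] at h hs'
  exact h.trans_eq hs'

/-- for a Hamiltonian geometric action with `H(x,0) = 0`, motion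
along the natural drift `b(x) = H_θ(x,0)` is free: `ℓ(x, c·b(x)) = 0` for
`c ≥ 0`, and consequently any absolutely continuous curve following the drift
flowlines has zero action. -/
theorem statement17 {n : ℕ} (D : Set (Euc n)) (hD : IsOpen D) (hDne : D.Nonempty)
    (H : Euc n → Euc n → ℝ)
    (Hθ : Euc n → Euc n → Euc n)
    (Hθθ : Euc n → Euc n → (Euc n →L[ℝ] Euc n))
    (hHcont : ContinuousOn (fun p : Euc n × Euc n => H p.1 p.2) (D ×ˢ Set.univ))
    (hH1' : ∀ x ∈ D, H x 0 = 0)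
    (hHθ : ∀ x ∈ D, ∀ θ : Euc n, HasGradientAt (H x) (Hθ x θ) θ)
    (hHθθ : ∀ x ∈ D, ∀ θ : Euc n, HasFDerivAt (Hθ x) (Hθθ x θ) θ)
    (hHθcont : ContinuousOn (fun p : Euc n × Euc n => Hθ p.1 p.2) (D ×ˢ Set.univ))
    (hHθθcont : ContinuousOn (fun p : Euc n × Euc n => Hθθ p.1 p.2) (D ×ˢ Set.univ))
    (hH3 : ∀ K ⊆ D, IsCompact K → ∃ m > (0:ℝ), ∀ x ∈ K, ∀ θ ξ : Euc n,
      m * ‖ξ‖ ^ 2 ≤ ⟪ξ, Hθθ x θ ξ⟫)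
    (ℓ : Euc n → Euc n → ℝ)
    (hℓdef : ∀ x y : Euc n, ℓ x y = sSup ((fun θ => ⟪y, θ⟫) '' {θ | H x θ ≤ 0})) :
    (∀ x ∈ D, ∀ c : ℝ, 0 ≤ c → ℓ x (c • Hθ x 0) = 0) ∧
    (∀ φ φ' : ℝ → Euc n, GeoAC φ φ' → (∀ t ∈ Set.Icc (0:ℝ) 1, φ t ∈ D) →
      ∀ c : ℝ → ℝ, Measurable c → (∀ α, 0 ≤ c α) →
      (∀ᵐ α ∂(volume.restrict (Set.Icc (0:ℝ) 1)), φ' α = c α • Hθ (φ α) 0) →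
      ∫ α in (0:ℝ)..1, ℓ (φ α) (φ' α) = 0) := by
  have hdrift : ∀ x ∈ D, ∀ c : ℝ, 0 ≤ c → ℓ x (c • Hθ x 0) = 0 := by
    intro x hx c hc
    obtain ⟨m, hm, hpos⟩ := hH3 {x} (singleton_subset_iff.2 hx) isCompact_singleton
    have hA (θ ξ : Euc n) : 0 ≤ ⟪ξ, Hθθ x θ ξ⟫ :=
      le_trans (by positivity) (hpos x rfl θ ξ)
    rw [hℓdef]
    refine IsGreatest.csSup_eq ⟨⟨0, (hH1' x hx).le, inner_zero_right _⟩, ?_⟩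
    rintro _ ⟨θ, hθ, rfl⟩
    have h := inner_gradient_zero_le_sub (hHθ x hx) (hHθθ x hx) hA θ
    rw [hH1' x hx, sub_zero] at h
    simp only [real_inner_smul_left]
    exact mul_nonpos_of_nonneg_of_nonpos hc (h.trans hθ)
  refine ⟨hdrift, fun φ φ' _ hφD c _ hc hφ' => intervalIntegral.integral_zero_ae ?_⟩
  filter_upwards [(ae_restrict_iff' measurableSet_Icc).1 hφ'] with α hα hmem
  rw [uIoc_of_le zero_le_one] at hmem
  have hα01 := Ioc_subset_Icc_self hmem
  rw [hα hα01]
  exact hdrift _ (hφD α hα01) _ (hc α)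
end

section
/- Let D ⊆ ℝⁿ be open, let H : D × ℝⁿ → ℝ be continuous and satisfy (H1)–(H3), let ℓ(x,y) := sup{⟨y,θ⟩ : θ ∈ ℝⁿ, H(x,θ) ≤ 0}, and let x ∈ D. Assume the maps w ↦ H(w,0) and w ↦ H_θ(w,0) are locally Hölder continuous at x, i.e. there exist a, γ, ρ₀ > 0 with closedBall(x,ρ₀) ⊆ D such that |H(w,0) − H(x,0)| ≤ a·|w−x|^γ and |H_θ(w,0) − H_θ(x,0)| ≤ a·|w−x|^γ for all w ∈ closedBall(x,ρ₀). Then the following are equivalent: (a) x is a critical point, i.e. ℓ(x,y) = 0 for every y ∈ ℝⁿ; (b) there exist ρ, C, δ > 0 such that ℓ(w,y) ≤ C·|w−x|^δ·|y| for all w ∈ closedBall(x,ρ) and all y ∈ ℝⁿ. -/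
open MeasureTheory Set Filter
open scoped RealInnerProductSpace

open scoped Topology

section StrongConvexity

variable {E : Type*} [NormedAddCommGroup E] [InnerProductSpace ℝ E]

/-- Second-order lower bound for a function whose Hessian is bounded below by `m`. -/
theorem quadratic_lower_bound_of_hessian [CompleteSpace E] {f : E → ℝ} {g : E → E} {A : E → E →L[ℝ] E} {m : ℝ}
    (hf : ∀ θ, HasGradientAt f (g θ) θ) (hg : ∀ θ, HasFDerivAt g (A θ) θ)
    (hA : ∀ θ ξ, m * ‖ξ‖ ^ 2 ≤ ⟪ξ, A θ ξ⟫) (θ : E) :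
    f 0 + ⟪g 0, θ⟫ + m / 2 * ‖θ‖ ^ 2 ≤ f θ := by
  have hline (t : ℝ) : HasDerivAt (fun s : ℝ => s • θ) θ t := by
    simpa using (hasDerivAt_id t).smul_const θ
  have hgline (t : ℝ) : HasDerivAt (fun s : ℝ => ⟪θ, g (s • θ)⟫ - m * ‖θ‖ ^ 2 * s)
      (⟪θ, A (t • θ) θ⟫ - m * ‖θ‖ ^ 2) t := by
    have h1 := (hg (t • θ)).comp_hasDerivAt t (hline t)
    have h2 := ((hasDerivAt_const t θ).inner ℝ h1).sub
      ((hasDerivAt_id t).const_mul (m * ‖θ‖ ^ 2))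
    refine h2.congr_deriv ?_
    simp
  have hgmono : Monotone (fun s : ℝ => ⟪θ, g (s • θ)⟫ - m * ‖θ‖ ^ 2 * s) :=
    monotone_of_hasDerivAt_nonneg hgline fun t => sub_nonneg.2 (hA _ _)
  have hfline (t : ℝ) :
      HasDerivAt (fun s : ℝ => f (s • θ) - ⟪g 0, θ⟫ * s - m / 2 * ‖θ‖ ^ 2 * s ^ 2)
      (⟪g (t • θ), θ⟫ - ⟪g 0, θ⟫ - m * ‖θ‖ ^ 2 * t) t := by
    have h1 := (hf (t • θ)).hasFDerivAt.comp_hasDerivAt t (hline t)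
    have h2 := (h1.sub ((hasDerivAt_id t).const_mul ⟪g 0, θ⟫)).sub
      ((hasDerivAt_pow 2 t).const_mul (m / 2 * ‖θ‖ ^ 2))
    refine h2.congr_deriv ?_
    simp
    ring
  have hfmono : MonotoneOn
      (fun s : ℝ => f (s • θ) - ⟪g 0, θ⟫ * s - m / 2 * ‖θ‖ ^ 2 * s ^ 2) (Set.Ici 0) := by
    refine monotoneOn_of_deriv_nonneg (convex_Ici 0)
      (fun t _ => (hfline t).continuousAt.continuousWithinAt)
      (fun t _ => (hfline t).differentiableAt.differentiableWithinAt) fun t ht => ?_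
    rw [interior_Ici] at ht
    rw [(hfline t).deriv, real_inner_comm, real_inner_comm θ (g 0)]
    have := hgmono (le_of_lt (Set.mem_Ioi.1 ht))
    simp only [zero_smul, mul_zero, sub_zero] at this
    linarith
  have := hfmono (Set.mem_Ici.2 le_rfl) (Set.mem_Ici.2 zero_le_one) zero_le_one
  simp only [zero_smul, one_smul] at this
  linarith

/-- Sublevel sets of a function with a quadratic lower bound are bounded. -/
theorem norm_le_of_quadratic_lower_bound {f : E → ℝ} {v θ : E} {m : ℝ} (hm : 0 < m)
    (hf : f 0 + ⟪v, θ⟫ + m / 2 * ‖θ‖ ^ 2 ≤ f θ) (hθ : f θ ≤ 0) :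
    ‖θ‖ ≤ 1 + 2 * (|f 0| + ‖v‖) / m := by
  by_contra! hlt
  have hv := neg_le_of_abs_le (abs_real_inner_le_norm v θ)
  have h0 := neg_abs_le (f 0)
  have h1 : 1 ≤ ‖θ‖ := by
    have : 0 ≤ 2 * (|f 0| + ‖v‖) / m := by positivity
    linarith
  have h2 : 2 * (|f 0| + ‖v‖) < m * ‖θ‖ := by
    have : 2 * (|f 0| + ‖v‖) / m < ‖θ‖ := by linarith
    rw [div_lt_iff₀ hm] at this
    linarith
  nlinarith [abs_nonneg (f 0), mul_lt_mul_of_pos_right h2 (zero_lt_one.trans_le h1),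
    mul_le_mul_of_nonneg_left h1 (abs_nonneg (f 0))]

end StrongConvexity

/-- A quadratic inequality with perturbation of size `s ^ 2` confines `t` to size `s`. -/
theorem le_mul_of_quadratic_le {m a s t : ℝ} (hm : 0 < m) (ha : 0 < a) (hs : 0 ≤ s)
    (hs1 : s ≤ 1) (ht : 0 ≤ t) (h : m / 2 * t ^ 2 ≤ a * s ^ 2 + a * s ^ 2 * t) :
    t ≤ (1 + 4 * a / m) * s := by
  by_contra! hlt
  have hq : 0 ≤ 4 * a / m * s := by positivity
  have hst : s < t := by nlinarith
  have htpos : 0 < t := hs.trans_lt hst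
  have h1 : a * s ^ 2 ≤ a * s * t := by nlinarith [mul_nonneg ha.le hs]
  have h2 : a * s ^ 2 * t ≤ a * s * t := by
    nlinarith [mul_nonneg (mul_nonneg ha.le hs) ht]
  have h3 : 4 * a * s < m * t := by
    have : 4 * a / m * s < t := by nlinarith
    rw [div_mul_eq_mul_div, div_lt_iff₀ hm] at this
    linarith
  nlinarith [mul_lt_mul_of_pos_right h3 htpos]

/-- if `H(·,0)` and `H_θ(·,0)` are locally Hölder continuous at
`x`, then `x` is a critical point of the induced geometric action if and only
if `ℓ` satisfies a local Hölder-type upper bound `ℓ(w,y) ≤ C|w−x|^δ|y|`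
near `x`. -/
theorem statement18 {n : ℕ} (D : Set (Euc n)) (hD : IsOpen D) (hDne : D.Nonempty)
    (H : Euc n → Euc n → ℝ)
    (Hθ : Euc n → Euc n → Euc n)
    (Hθθ : Euc n → Euc n → (Euc n →L[ℝ] Euc n))
    (hHcont : ContinuousOn (fun p : Euc n × Euc n => H p.1 p.2) (D ×ˢ Set.univ))
    (hH1 : ∀ x ∈ D, H x 0 ≤ 0)
    (hHθ : ∀ x ∈ D, ∀ θ : Euc n, HasGradientAt (H x) (Hθ x θ) θ)
    (hHθθ : ∀ x ∈ D, ∀ θ : Euc n, HasFDerivAt (Hθ x) (Hθθ x θ) θ)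
    (hHθcont : ContinuousOn (fun p : Euc n × Euc n => Hθ p.1 p.2) (D ×ˢ Set.univ))
    (hHθθcont : ContinuousOn (fun p : Euc n × Euc n => Hθθ p.1 p.2) (D ×ˢ Set.univ))
    (hH3 : ∀ K ⊆ D, IsCompact K → ∃ m > (0:ℝ), ∀ x ∈ K, ∀ θ ξ : Euc n,
      m * ‖ξ‖ ^ 2 ≤ ⟪ξ, Hθθ x θ ξ⟫)
    (ℓ : Euc n → Euc n → ℝ)
    (hℓdef : ∀ x y : Euc n, ℓ x y = sSup ((fun θ => ⟪y, θ⟫) '' {θ | H x θ ≤ 0}))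
    (x : Euc n) (hx : x ∈ D)
    (a γ ρ₀ : ℝ) (ha : 0 < a) (hγ : 0 < γ) (hρ₀ : 0 < ρ₀)
    (hball : Metric.closedBall x ρ₀ ⊆ D)
    (hHolder1 : ∀ w ∈ Metric.closedBall x ρ₀, |H w 0 - H x 0| ≤ a * ‖w - x‖ ^ γ)
    (hHolder2 : ∀ w ∈ Metric.closedBall x ρ₀, ‖Hθ w 0 - Hθ x 0‖ ≤ a * ‖w - x‖ ^ γ) :
    (∀ y : Euc n, ℓ x y = 0) ↔
      (∃ ρ > (0:ℝ), ∃ C > (0:ℝ), ∃ δ > (0:ℝ),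
        ∀ w ∈ Metric.closedBall x ρ ∩ D, ∀ y : Euc n,
          ℓ w y ≤ C * ‖w - x‖ ^ δ * ‖y‖) := by
  have hquad : ∀ K ⊆ D, IsCompact K → ∃ m > (0:ℝ), ∀ w ∈ K, ∀ θ : Euc n,
      H w 0 + ⟪Hθ w 0, θ⟫ + m / 2 * ‖θ‖ ^ 2 ≤ H w θ := by
    intro K hK hKc
    obtain ⟨m, hm, hmK⟩ := hH3 K hK hKc
    exact ⟨m, hm, fun w hw => quadratic_lower_bound_of_hessian (hHθ w (hK hw))
      (hHθθ w (hK hw)) (hmK w hw)⟩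
  have hle : ∀ y θ : Euc n, H x θ ≤ 0 → ⟪y, θ⟫ ≤ ℓ x y := by
    intro y θ hθ
    obtain ⟨m, hm, hmK⟩ := hquad {x} (by simpa using hx) isCompact_singleton
    rw [hℓdef]
    refine le_csSup ⟨‖y‖ * (1 + 2 * (|H x 0| + ‖Hθ x 0‖) / m), ?_⟩ ⟨θ, hθ, rfl⟩
    rintro _ ⟨η, hη, rfl⟩
    exact (real_inner_le_norm _ _).trans (mul_le_mul_of_nonneg_left
      (norm_le_of_quadratic_lower_bound hm (hmK x rfl η) hη) (norm_nonneg _))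
  constructor
  · intro hcrit
    have hzero : ∀ θ : Euc n, H x θ ≤ 0 → θ = 0 := fun θ hθ => by
      have := hle θ θ hθ
      rw [hcrit] at this
      exact real_inner_self_nonpos.1 this
    have hgrad : Hθ x 0 = 0 := by
      have hmin : IsLocalMin (H x) 0 := Filter.Eventually.of_forall fun θ => by
        by_contra! hlt
        have h0 := hzero θ (hlt.le.trans (hH1 x hx))
        rw [h0] at hlt
        exact lt_irrefl _ hlt
      simpa using hmin.hasFDerivAt_eq_zero (hHθ x hx 0).hasFDerivAt
    rcases subsingleton_or_nontrivial (Euc n) with hsub | hnt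
    · refine ⟨1, one_pos, 1, one_pos, 1, one_pos, fun w _ y => ?_⟩
      rw [hℓdef]
      refine Real.sSup_le ?_ (by positivity)
      rintro _ ⟨θ, _, rfl⟩
      simp only [Subsingleton.elim θ 0, inner_zero_right]
      positivity
    have hval : H x 0 = 0 := by
      refine le_antisymm (hH1 x hx) ?_
      by_contra! hlt
      have hev : ∀ᶠ θ in 𝓝 (0 : Euc n), H x θ < 0 :=
        (hHθ x hx 0).hasFDerivAt.continuousAt.eventually_lt continuousAt_const hlt
      obtain ⟨θ, hθ, hne⟩ := ((hev.filter_mono nhdsWithin_le_nhds).and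
        (self_mem_nhdsWithin : {(0 : Euc n)}ᶜ ∈ 𝓝[≠] (0 : Euc n))).exists
      exact hne (hzero θ hθ.le)
    obtain ⟨m, hm, hmK⟩ := hquad _ hball (isCompact_closedBall x ρ₀)
    refine ⟨min ρ₀ 1, lt_min hρ₀ one_pos, 1 + 4 * a / m, by positivity, γ / 2, half_pos hγ, ?_⟩
    rintro w ⟨hw, -⟩ y
    have hwρ : w ∈ Metric.closedBall x ρ₀ :=
      Metric.closedBall_subset_closedBall (min_le_left _ _) hw
    have hw1 : ‖w - x‖ ≤ 1 := by
      rw [← dist_eq_norm]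
      exact (Metric.mem_closedBall.1 hw).trans (min_le_right _ _)
    have hsq : ‖w - x‖ ^ γ = (‖w - x‖ ^ (γ / 2)) ^ 2 := by
      rw [← Real.rpow_natCast, ← Real.rpow_mul (norm_nonneg _)]
      norm_num
    have hs : 0 ≤ ‖w - x‖ ^ (γ / 2) := by positivity
    have hs1 : ‖w - x‖ ^ (γ / 2) ≤ 1 :=
      Real.rpow_le_one (norm_nonneg _) hw1 (half_pos hγ).le
    have h1 := hHolder1 w hwρ
    have h2 := hHolder2 w hwρ
    rw [hval, sub_zero, hsq] at h1
    rw [hgrad, sub_zero, hsq] at h2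
    rw [hℓdef]
    refine Real.sSup_le ?_ (by positivity)
    rintro _ ⟨θ, hθ, rfl⟩
    have hbound : ‖θ‖ ≤ (1 + 4 * a / m) * ‖w - x‖ ^ (γ / 2) := by
      refine le_mul_of_quadratic_le hm ha hs hs1 (norm_nonneg _) ?_
      have hθ' : H w θ ≤ 0 := hθ
      have h3 := hmK w hwρ θ
      have h4 := neg_le_of_abs_le (abs_real_inner_le_norm (Hθ w 0) θ)
      have h5 := neg_le_of_abs_le h1
      have h6 := mul_le_mul_of_nonneg_right h2 (norm_nonneg θ)
      linarith
    calc ⟪y, θ⟫ ≤ ‖y‖ * ‖θ‖ := real_inner_le_norm _ _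
      _ ≤ ‖y‖ * ((1 + 4 * a / m) * ‖w - x‖ ^ (γ / 2)) :=
        mul_le_mul_of_nonneg_left hbound (norm_nonneg _)
      _ = _ := mul_comm _ _
  · rintro ⟨ρ, hρ, C, -, δ, hδ, hC⟩ y
    refine le_antisymm ?_ (by simpa using hle y 0 (hH1 x hx))
    simpa [Real.zero_rpow hδ.ne'] using hC x ⟨Metric.mem_closedBall_self hρ.le, hx⟩ y
end
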